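/- Let ℒ be a distributive abstract logic with space X. Then X is a T₀ space and X is sober: every nonempty irreducible closed subset of X has a unique generic point. If moreover ℒ is bounded, then X is a spectral space. -/

import Mathlib

/-- An abstract logic: a nonempty family of theories on `Expr`
closed under intersections of nonempty subfamilies. -/
def IsAbstractLogic {Expr : Type*} (Th : Set (Set Expr)) : Prop :=
  Th.Nonempty ∧ ∀ 𝒯 ⊆ Th, 𝒯.Nonempty → ⋂₀ 𝒯 ∈ Th

/-- The logic is closed under chains: the union of every nonempty chain of
theories is a theory. -/
def ChainClosed {Expr : Type*} (Th : Set (Set Expr)) : Prop :=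
  ∀ 𝒯 ⊆ Th, 𝒯.Nonempty → IsChain (· ⊆ ·) 𝒯 → ⋃₀ 𝒯 ∈ Th

/-- A theory is totally prime if whenever it is the intersection of a nonempty
family of theories, it belongs to that family. -/
def TotallyPrimeTheory {Expr : Type*} (Th : Set (Set Expr)) (T : Set Expr) : Prop :=
  T ∈ Th ∧ ∀ 𝒯 ⊆ Th, 𝒯.Nonempty → T = ⋂₀ 𝒯 → T ∈ 𝒯

/-- A theory is prime if whenever it is the intersection of two theories,
it equals one of them. -/
def PrimeTheory {Expr : Type*} (Th : Set (Set Expr)) (T : Set Expr) : Prop :=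
  T ∈ Th ∧ ∀ T₁ ∈ Th, ∀ T₂ ∈ Th, T = T₁ ∩ T₂ → T = T₁ ∨ T = T₂

/-- A distributive abstract logic: an abstract logic closed under chains with
binary operations `vee` (disjunction) and `wedge` (conjunction) behaving as
expected on all totally prime theories. -/
def IsDistributiveLogic {Expr : Type*} (Th : Set (Set Expr))
    (vee wedge : Expr → Expr → Expr) : Prop :=
  IsAbstractLogic Th ∧ ChainClosed Th ∧
  (∀ T, TotallyPrimeTheory Th T → ∀ a b, vee a b ∈ T ↔ (a ∈ T ∨ b ∈ T)) ∧
  (∀ T, TotallyPrimeTheory Th T → ∀ a b, wedge a b ∈ T ↔ (a ∈ T ∧ b ∈ T))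

/-- The space of a distributive abstract logic: the set of its prime theories. -/
structure LogicSpace {Expr : Type*} (Th : Set (Set Expr)) where
  val : Set Expr
  prime : PrimeTheory Th val

/-- The basic open set `a^X = { P ∈ PTh | a ∈ P }`. -/
def basicSet {Expr : Type*} (Th : Set (Set Expr)) (a : Expr) : Set (LogicSpace Th) :=
  {P | a ∈ P.val}

/-- The topology on the space of prime theories generated by the base
`Λ(X) = { a^X | a ∈ Expr }`. -/
instance {Expr : Type*} (Th : Set (Set Expr)) : TopologicalSpace (LogicSpace Th) :=
  TopologicalSpace.generateFrom (Set.range (basicSet Th))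

/-- A spectral space: compact, T₀, the compact opens form a base closed under
finite (binary) intersections, and every nonempty irreducible closed subset
has a generic point (i.e. the space is quasi-sober). -/
def IsSpectral (X : Type*) [TopologicalSpace X] : Prop :=
  CompactSpace X ∧ T0Space X ∧
  TopologicalSpace.IsTopologicalBasis {U : Set X | IsOpen U ∧ IsCompact U} ∧
  (∀ U V : Set X, IsOpen U → IsCompact U → IsOpen V → IsCompact V →
    IsOpen (U ∩ V) ∧ IsCompact (U ∩ V)) ∧
  QuasiSober X

section LogicSpace

open Set TopologicalSpace
open scoped Cardinal

variable {Expr : Type*} {Th : Set (Set Expr)} {vee wedge : Expr → Expr → Expr}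

/-- In a family of sets closed under nonempty intersections and unions of chains, the
closure of a set, all of whose finite subsets lie in a member, is a member. -/
theorem finitaryClosure_mem (hI : IsAbstractLogic Th) (hC : ChainClosed Th) (A : Set Expr)
    (hA : ∀ s ⊆ A, s.Finite → ∃ T ∈ Th, s ⊆ T) :
    {c | ∃ s ⊆ A, s.Finite ∧ ∀ T ∈ Th, s ⊆ T → c ∈ T} ∈ Th := by
  induction hκ : #A using WellFoundedLT.induction generalizing A with
  | ind κ ih =>
  by_cases hfin : A.Finite
  · obtain ⟨T₀, hT₀, hAT₀⟩ := hA A subset_rfl hfin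
    convert hI.2 {T | T ∈ Th ∧ A ⊆ T} (fun T hT => hT.1) ⟨T₀, hT₀, hAT₀⟩ using 1
    ext c
    constructor
    · rintro ⟨s, hsA, -, hs⟩ T ⟨hT, hAT⟩
      exact hs T hT (hsA.trans hAT)
    · intro hc
      exact ⟨A, subset_rfl, hfin, fun T hT hAT => hc T ⟨hT, hAT⟩⟩
  · have hinf : Infinite A := infinite_coe_iff.2 hfin
    obtain ⟨_, _, hord⟩ := Cardinal.exists_ord_eq_type_lt A
    let G : Set Expr → Set Expr := fun B => {c | ∃ s ⊆ B, s.Finite ∧ ∀ T ∈ Th, s ⊆ T → c ∈ T}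
    have hG : ∀ {B C : Set Expr}, B ⊆ C → G B ⊆ G C :=
      fun hBC _ ⟨s, hs, h⟩ => ⟨s, hs.trans hBC, h⟩
    let I : A → Set Expr := fun i => Subtype.val '' Iic i
    have hIA : ∀ i, I i ⊆ A := fun i => Subtype.coe_image_subset _ _
    have hI_mono : ∀ {i j}, i ≤ j → I i ⊆ I j := fun hij => image_mono (Iic_subset_Iic.2 hij)
    have hI_mem : ∀ i, G (I i) ∈ Th := by
      intro i
      refine ih #(I i) ?_ (I i) (fun s hs => hA s (hs.trans (hIA i))) rfl
      rw [← hκ, Cardinal.mk_image_eq Subtype.val_injective, ← Iio_insert]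
      refine Cardinal.mk_insert_le.trans_lt (Cardinal.add_lt_of_lt (Cardinal.aleph0_le_mk A)
        (Cardinal.mk_Iio_lt i hord) ?_)
      exact Cardinal.one_lt_aleph0.trans_le (Cardinal.aleph0_le_mk A)
    have hU : G A = ⋃₀ range (fun i => G (I i)) := by
      apply subset_antisymm
      · rintro c ⟨s, hsA, hs, hc⟩
        have hs' : (Subtype.val ⁻¹' s : Set A).Finite := hs.preimage Subtype.val_injective.injOn
        obtain ⟨i, hi⟩ := hs'.bddAbove
        exact ⟨_, ⟨i, rfl⟩, s, fun x hx => ⟨⟨x, hsA hx⟩, hi hx, rfl⟩, hs, hc⟩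
      · rintro c ⟨_, ⟨i, rfl⟩, hc⟩
        exact hG (hIA i) hc
    change G A ∈ Th
    rw [hU]
    refine hC _ (range_subset_iff.2 hI_mem) (range_nonempty _) ?_
    rintro _ ⟨i, rfl⟩ _ ⟨j, rfl⟩ -
    exact (le_total i j).imp (fun h => hG (hI_mono h)) (fun h => hG (hI_mono h))

/-- A theory omitting a set of formulas extends to one maximal with that property. -/
theorem exists_maximal_theory_disjoint (hC : ChainClosed Th) {T B : Set Expr} (hT : T ∈ Th)
    (hB : Disjoint T B) : ∃ M, T ⊆ M ∧ Maximal (fun S => S ∈ Th ∧ Disjoint S B) M := by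
  refine zorn_subset_nonempty {S | S ∈ Th ∧ Disjoint S B} ?_ T ⟨hT, hB⟩
  intro c hc hchain hne
  refine ⟨⋃₀ c, ⟨hC c (fun S hS => (hc hS).1) hne hchain, ?_⟩, fun S => subset_sUnion_of_mem⟩
  exact disjoint_sUnion_left.2 fun S hS => (hc hS).2

theorem exists_totallyPrimeTheory_notMem (hC : ChainClosed Th) {T : Set Expr} {c : Expr}
    (hT : T ∈ Th) (hc : c ∉ T) : ∃ M, TotallyPrimeTheory Th M ∧ T ⊆ M ∧ c ∉ M := by
  obtain ⟨M, hTM, hM⟩ := exists_maximal_theory_disjoint hC hT (disjoint_singleton_right.2 hc)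
  have hcM : c ∉ M := disjoint_singleton_right.1 hM.prop.2
  refine ⟨M, ⟨hM.prop.1, fun 𝒯 h𝒯 _ hMe => ?_⟩, hTM, hcM⟩
  obtain ⟨N, hN, hcN⟩ : ∃ N ∈ 𝒯, c ∉ N := by
    by_contra! h
    exact hcM (hMe ▸ h)
  have hMN : M ⊆ N := hMe.trans_subset (sInter_subset_of_mem hN)
  rwa [hM.eq_of_subset ⟨h𝒯 hN, disjoint_singleton_right.2 hcN⟩ hMN]

theorem vee_mem_of_mem (hD : IsDistributiveLogic Th vee wedge) {T : Set Expr} (hT : T ∈ Th)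
    {a b : Expr} (h : a ∈ T ∨ b ∈ T) : vee a b ∈ T := by
  by_contra hc
  obtain ⟨M, hM, hTM, hcM⟩ := exists_totallyPrimeTheory_notMem hD.2.1 hT hc
  exact hcM ((hD.2.2.1 M hM a b).2 (h.imp (@hTM a) (@hTM b)))

theorem wedge_mem_iff (hD : IsDistributiveLogic Th vee wedge) {T : Set Expr} (hT : T ∈ Th)
    {a b : Expr} : wedge a b ∈ T ↔ a ∈ T ∧ b ∈ T := by
  constructor
  · intro h
    by_contra hab
    rw [not_and_or] at hab
    rcases hab with hc | hc <;>
    · obtain ⟨M, hM, hTM, hcM⟩ := exists_totallyPrimeTheory_notMem hD.2.1 hT hc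
      have := (hD.2.2.2 M hM a b).1 (hTM h)
      tauto
  · intro h
    by_contra hc
    obtain ⟨M, hM, hTM, hcM⟩ := exists_totallyPrimeTheory_notMem hD.2.1 hT hc
    exact hcM ((hD.2.2.2 M hM a b).2 (h.imp (@hTM a) (@hTM b)))

theorem PrimeTheory.mem_or_mem (hD : IsDistributiveLogic Th vee wedge) {P : Set Expr}
    (hP : PrimeTheory Th P) {a b : Expr} (h : vee a b ∈ P) : a ∈ P ∨ b ∈ P := by
  by_contra! hab
  obtain ⟨Ma, hMa, hPMa, haM⟩ := exists_totallyPrimeTheory_notMem hD.2.1 hP.1 hab.1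
  obtain ⟨Mb, hMb, hPMb, hbM⟩ := exists_totallyPrimeTheory_notMem hD.2.1 hP.1 hab.2
  have haMb : a ∈ Mb := ((hD.2.2.1 Mb hMb a b).1 (hPMb h)).resolve_right hbM
  have hbMa : b ∈ Ma := ((hD.2.2.1 Ma hMa a b).1 (hPMa h)).resolve_left haM
  have hgen : ∀ c, ∀ M, M ∈ Th → P ⊆ M → c ∈ M → ⋂₀ {T | T ∈ Th ∧ P ⊆ T ∧ c ∈ T} ∈ Th :=
    fun c M hM hPM hc => hD.1.2 _ (fun T hT => hT.1) ⟨M, hM, hPM, hc⟩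
  have hinter : P = ⋂₀ {T | T ∈ Th ∧ P ⊆ T ∧ a ∈ T} ∩ ⋂₀ {T | T ∈ Th ∧ P ⊆ T ∧ b ∈ T} := by
    apply subset_antisymm
    · exact subset_inter (subset_sInter fun T hT => hT.2.1) (subset_sInter fun T hT => hT.2.1)
    · rintro c ⟨hca, hcb⟩
      by_contra hc
      obtain ⟨M, hM, hPM, hcM⟩ := exists_totallyPrimeTheory_notMem hD.2.1 hP.1 hc
      rcases (hD.2.2.1 M hM a b).1 (hPM h) with ha | hb
      · exact hcM (hca M ⟨hM.1, hPM, ha⟩)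
      · exact hcM (hcb M ⟨hM.1, hPM, hb⟩)
  rcases hP.2 _ (hgen a Mb hMb.1 hPMb haMb) _ (hgen b Ma hMa.1 hPMa hbMa) hinter with he | he
  · exact hab.1 (he.symm.subset fun T hT => hT.2.2)
  · exact hab.2 (he.symm.subset fun T hT => hT.2.2)

theorem PrimeTheory.of_mem_or_mem (hD : IsDistributiveLogic Th vee wedge) {P : Set Expr}
    (hP : P ∈ Th) (h : ∀ a b, vee a b ∈ P → a ∈ P ∨ b ∈ P) : PrimeTheory Th P := by
  refine ⟨hP, fun T₁ hT₁ T₂ hT₂ he => ?_⟩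
  by_contra! hne
  have h₁ : ¬ T₁ ⊆ P := fun hs => hne.1 (subset_antisymm (he.trans_subset inter_subset_left) hs)
  have h₂ : ¬ T₂ ⊆ P := fun hs => hne.2 (subset_antisymm (he.trans_subset inter_subset_right) hs)
  obtain ⟨a, ha, haP⟩ := not_subset.1 h₁
  obtain ⟨b, hb, hbP⟩ := not_subset.1 h₂
  have hab : vee a b ∈ P :=
    he ▸ ⟨vee_mem_of_mem hD hT₁ (.inl ha), vee_mem_of_mem hD hT₂ (.inr hb)⟩
  exact (h a b hab).elim haP hbP

theorem isOpen_basicSet (a : Expr) : IsOpen (basicSet Th a) :=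
  isOpen_generateFrom_of_mem ⟨a, rfl⟩

theorem basicSet_inter (hD : IsDistributiveLogic Th vee wedge) (a b : Expr) :
    basicSet Th a ∩ basicSet Th b = basicSet Th (wedge a b) := by
  ext P
  exact (wedge_mem_iff hD P.prime.1).symm

theorem isTopologicalBasis_basicSet (hD : IsDistributiveLogic Th vee wedge) :
    IsTopologicalBasis (insert univ (range (basicSet Th))) := by
  refine isTopologicalBasis_of_subbasis_of_inter rfl ?_
  rintro _ ⟨a, rfl⟩ _ ⟨b, rfl⟩
  exact ⟨wedge a b, (basicSet_inter hD a b).symm⟩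

theorem isCompact_basicSet (hD : IsDistributiveLogic Th vee wedge) (a : Expr) :
    IsCompact (basicSet Th a) := by
  refine isCompact_generateFrom rfl fun 𝒰 h𝒰 hcov => ?_
  by_contra! hno
  let B : Set Expr := {d | ∃ Q ⊆ 𝒰, Q.Finite ∧ basicSet Th d ⊆ ⋃₀ Q}
  have ha : (basicSet Th a).Nonempty := by
    by_contra! he
    exact hno ∅ (empty_subset _) finite_empty (by simp [he])
  obtain ⟨P₀, hP₀⟩ := ha
  have hcl : ⋂₀ {T | T ∈ Th ∧ a ∈ T} ∈ Th :=
    hD.1.2 _ (fun T hT => hT.1) ⟨P₀.val, P₀.prime.1, hP₀⟩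
  have hdisj : Disjoint (⋂₀ {T | T ∈ Th ∧ a ∈ T}) B := by
    refine disjoint_left.2 fun d hd ⟨Q, hQ, hQfin, hdQ⟩ => hno Q hQ hQfin ?_
    exact Subset.trans (fun P hP => hd P.val ⟨P.prime.1, hP⟩) hdQ
  obtain ⟨M, hclM, hM⟩ := exists_maximal_theory_disjoint hD.2.1 hcl hdisj
  have hprime : PrimeTheory Th M := by
    refine ⟨hM.prop.1, fun T₁ hT₁ T₂ hT₂ he => ?_⟩
    by_contra! hne
    have hmeet : ∀ T ∈ Th, M ⊆ T → M ≠ T → ∃ d ∈ T, d ∈ B := fun T hT hMT hMne =>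
      not_disjoint_iff.1 fun hTB => hMne (hM.eq_of_subset ⟨hT, hTB⟩ hMT)
    obtain ⟨d, hd, Q, hQ, hQfin, hdQ⟩ := hmeet T₁ hT₁ (he.trans_subset inter_subset_left) hne.1
    obtain ⟨e, hee, R, hR, hRfin, heR⟩ := hmeet T₂ hT₂ (he.trans_subset inter_subset_right) hne.2
    have hde : vee d e ∈ M :=
      he ▸ ⟨vee_mem_of_mem hD hT₁ (.inl hd), vee_mem_of_mem hD hT₂ (.inr hee)⟩
    refine disjoint_left.1 hM.prop.2 hde ⟨Q ∪ R, union_subset hQ hR, hQfin.union hRfin, ?_⟩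
    intro P hP
    rw [sUnion_union]
    exact (P.prime.mem_or_mem hD hP).imp (@hdQ P) (@heR P)
  obtain ⟨U, hU, hMU⟩ := hcov (show (⟨M, hprime⟩ : LogicSpace Th) ∈ basicSet Th a from
    hclM fun T hT => hT.2)
  obtain ⟨b, rfl⟩ := h𝒰 hU
  exact disjoint_left.1 hM.prop.2 hMU
    ⟨{basicSet Th b}, singleton_subset_iff.2 hU, finite_singleton _, by simp⟩

theorem t0Space_logicSpace : T0Space (LogicSpace Th) := by
  refine ⟨fun P Q h => ?_⟩
  have hval : P.val = Q.val := ext fun a => h.mem_open_iff (isOpen_basicSet a)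
  cases P
  cases Q
  congr

theorem exists_isGenericPoint_logicSpace (hD : IsDistributiveLogic Th vee wedge)
    {F : Set (LogicSpace Th)} (hFc : IsClosed F) (hF : IsIrreducible F) :
    ∃ P, IsGenericPoint P F := by
  classical
  let A : Set Expr := {a | (F ∩ basicSet Th a).Nonempty}
  have hfin : ∀ s ⊆ A, s.Finite → ∃ Q ∈ F, s ⊆ Q.val := by
    intro s hsA hs
    obtain ⟨Q, hQF, hQ⟩ := isIrreducible_iff_sInter.1 hF (hs.toFinset.image (basicSet Th))
      (by simpa using fun a _ => isOpen_basicSet a)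
      (by simpa using show ∀ a ∈ s, (F ∩ basicSet Th a).Nonempty from fun _ ha => hsA ha)
    exact ⟨Q, hQF, fun a ha => hQ (basicSet Th a) (by simpa using ⟨a, ha, rfl⟩)⟩
  have hA : A ∈ Th := by
    convert finitaryClosure_mem hD.1 hD.2.1 A fun s hsA hs =>
      (hfin s hsA hs).imp' LogicSpace.val fun Q hQ => ⟨Q.prime.1, hQ.2⟩ using 1
    apply subset_antisymm
    · exact fun a ha => ⟨{a}, singleton_subset_iff.2 ha, finite_singleton a,
        fun T _ haT => haT rfl⟩
    · rintro c ⟨s, hsA, hs, hc⟩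
      obtain ⟨Q, hQF, hsQ⟩ := hfin s hsA hs
      exact ⟨Q, hQF, hc Q.val Q.prime.1 hsQ⟩
  have hprime : PrimeTheory Th A := by
    refine .of_mem_or_mem hD hA ?_
    rintro a b ⟨Q, hQF, hQ⟩
    exact (Q.prime.mem_or_mem hD hQ).imp (fun h => ⟨Q, hQF, h⟩) (fun h => ⟨Q, hQF, h⟩)
  refine ⟨⟨A, hprime⟩, subset_antisymm (hFc.closure_subset_iff.2 ?_) fun Q hQ => ?_⟩
  · rw [singleton_subset_iff, ← hFc.closure_eq, (isTopologicalBasis_basicSet hD).mem_closure_iff]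
    rintro _ (rfl | ⟨a, rfl⟩) ha
    · simpa using hF.nonempty
    · rw [inter_comm]
      exact ha
  · rw [(isTopologicalBasis_basicSet hD).mem_closure_iff]
    rintro _ (rfl | ⟨a, rfl⟩) ha
    · simp
    · exact ⟨_, show a ∈ A from ⟨Q, hQ, ha⟩, rfl⟩

theorem isSpectral_logicSpace (hD : IsDistributiveLogic Th vee wedge)
    (hvalid : ∃ a, ∀ T ∈ Th, a ∈ T) : IsSpectral (LogicSpace Th) := by
  obtain ⟨a, ha⟩ := hvalid
  have huniv : basicSet Th a = univ := eq_univ_of_forall fun P => ha P.val P.prime.1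
  have hbasis : IsTopologicalBasis (range (basicSet Th)) := by
    simpa only [insert_eq_of_mem (show univ ∈ range (basicSet Th) from ⟨a, huniv⟩)] using
      isTopologicalBasis_basicSet hD
  have := PrespectralSpace.of_isTopologicalBasis' hbasis (isCompact_basicSet hD)
  have := QuasiSeparatedSpace.of_isTopologicalBasis hbasis fun b c => by
    simpa only [basicSet_inter hD] using isCompact_basicSet hD (wedge b c)
  refine ⟨⟨huniv ▸ isCompact_basicSet hD a⟩, t0Space_logicSpace,
    PrespectralSpace.isTopologicalBasis, fun U V hU hUc hV hVc => ⟨hU.inter hV, ?_⟩,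
    ⟨fun hS hSc => exists_isGenericPoint_logicSpace hD hSc hS⟩⟩
  exact QuasiSeparatedSpace.inter_isCompact U V hU hUc hV hVc

end LogicSpace

/-- The space of a distributive abstract logic is T₀ and sober
(every nonempty irreducible closed set has a unique generic point); if the
logic is bounded (has a valid and an inconsistent formula), the space is
spectral. -/
theorem space_sober_and_spectral {Expr : Type*} (Th : Set (Set Expr))
    (vee wedge : Expr → Expr → Expr) (hD : IsDistributiveLogic Th vee wedge) :
    T0Space (LogicSpace Th) ∧
    (∀ F : Set (LogicSpace Th), IsClosed F → IsIrreducible F →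
      ∃! P : LogicSpace Th, closure {P} = F) ∧
    (((∃ a : Expr, ∀ T ∈ Th, a ∈ T) ∧ (∃ b : Expr, ∀ T ∈ Th, b ∉ T)) →
      IsSpectral (LogicSpace Th)) := by
  have hT0 : T0Space (LogicSpace Th) := t0Space_logicSpace
  refine ⟨hT0, fun F hFc hF => ?_, fun h => isSpectral_logicSpace hD h.1⟩
  obtain ⟨P, hP⟩ := exists_isGenericPoint_logicSpace hD hFc hF
  exact ⟨P, hP, fun Q hQ => IsGenericPoint.eq hQ hP⟩
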